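/- Fix an integer n ≥ 2, x₀ > 0, σ > 0 and μ ≠ 0, and let s_B(x) = (σ²/(2μ))·(1 - exp(-2μx/σ²)). Let λ(·) = (1 - n·(·) + (n-1)·(·)^{n/(n-1)})/n, and for c ∈ [0,1) with (2μ/σ²)·(1-c)·s_B(x₀)/λ(c) < 1 let F_c be the equilibrium cdf F_c(x) = (c + λ(c)·s_B(x)/s_B(x₀))^{1/(n-1)} on [0, x̄(c)], x̄(c) = -(σ²/(2μ))·log(1 - (2μ/σ²)·(1-c)·s_B(x₀)/λ(c)), F_c = 1 above x̄(c). Define the mean m(c) = ∫₀^∞ (1 - F_c(x)) dx. Then for any 0 ≤ ĉ < c < 1 (both satisfying the displayed condition): if μ > 0 then m(ĉ) < m(c), and if μ < 0 then m(ĉ) > m(c). That is, the average equilibrium performance of an agent is strictly increasing in the submission fee when μ > 0 and strictly decreasing when μ < 0. -/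

import Mathlib

open MeasureTheory

/-- The slope coefficient `λ(c) = (1 - n·c + (n-1)·c^{n/(n-1)})/n` of the equilibrium
winning probability in the `n`-player risk-taking contest with submission fee `c`. -/
noncomputable def lamFee (n : ℕ) (c : ℝ) : ℝ :=
  (1 - n * c + ((n : ℝ) - 1) * c ^ ((n : ℝ) / ((n : ℝ) - 1))) / n

/-- Scale function of Brownian motion with drift `μ` and volatility `σ`:
`s_B(x) = (σ²/(2μ))·(1 - exp(-2μx/σ²))`. -/
noncomputable def sB (μ σ x : ℝ) : ℝ :=
  (σ ^ 2 / (2 * μ)) * (1 - Real.exp (-(2 * μ * x) / σ ^ 2))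

/-- Upper bound of the support of the equilibrium distribution for Brownian motion with
drift: `x̄(c) = -(σ²/(2μ))·log(1 - (2μ/σ²)·(1-c)·s_B(x₀)/λ(c))`. -/
noncomputable def driftXbar (n : ℕ) (x₀ μ σ c : ℝ) : ℝ :=
  -(σ ^ 2 / (2 * μ)) * Real.log (1 - (2 * μ / σ ^ 2) * ((1 - c) * sB μ σ x₀ / lamFee n c))

/-- Equilibrium cdf for Brownian motion with drift:
`F_c(x) = (c + λ(c)·s_B(x)/s_B(x₀))^{1/(n-1)}` on `[0, x̄(c)]`, `1` above, `0` below `0`. -/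
noncomputable def driftF (n : ℕ) (x₀ μ σ c x : ℝ) : ℝ :=
  if x < 0 then 0
  else if x ≤ driftXbar n x₀ μ σ c then
    (c + lamFee n c * sB μ σ x / sB μ σ x₀) ^ ((1 : ℝ) / ((n : ℝ) - 1))
  else 1

/-- Mean of the equilibrium distribution: `m(c) = ∫₀^∞ (1 - F_c(x)) dx`. -/
noncomputable def driftMean (n : ℕ) (x₀ μ σ c : ℝ) : ℝ :=
  ∫ x in Set.Ioi (0 : ℝ), (1 - driftF n x₀ μ σ c x)

theorem hasDerivAt_sB {μ σ : ℝ} (hσ : 0 < σ) (hμ : μ ≠ 0) (x : ℝ) :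
    HasDerivAt (sB μ σ) (Real.exp (-(2 * μ * x) / σ ^ 2)) x := by
  have h1 : HasDerivAt (fun x : ℝ => -(2 * μ * x) / σ ^ 2) (-(2 * μ * 1) / σ ^ 2) x :=
    (((hasDerivAt_id x).const_mul (2 * μ)).neg).div_const _
  have h2 := (h1.exp.const_sub 1).const_mul (σ ^ 2 / (2 * μ))
  refine h2.congr_deriv ?_
  field_simp

theorem continuous_sB {μ σ : ℝ} : Continuous (sB μ σ) := by
  unfold sB
  fun_prop

theorem strictMono_sB {μ σ : ℝ} (hσ : 0 < σ) (hμ : μ ≠ 0) : StrictMono (sB μ σ) :=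
  strictMono_of_hasDerivAt_pos (hasDerivAt_sB hσ hμ) fun _ => Real.exp_pos _

@[simp] theorem sB_zero (μ σ : ℝ) : sB μ σ 0 = 0 := by simp [sB]

theorem sB_pos {μ σ x : ℝ} (hσ : 0 < σ) (hμ : μ ≠ 0) (hx : 0 < x) : 0 < sB μ σ x := by
  simpa using strictMono_sB hσ hμ hx

theorem sB_driftXbar {n : ℕ} {x₀ μ σ c : ℝ} (hσ : 0 < σ) (hμ : μ ≠ 0)
    (hcond : (2 * μ / σ ^ 2) * ((1 - c) * sB μ σ x₀ / lamFee n c) < 1) :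
    sB μ σ (driftXbar n x₀ μ σ c) = (1 - c) * sB μ σ x₀ / lamFee n c := by
  set y := (1 - c) * sB μ σ x₀ / lamFee n c with hy
  have h : -(2 * μ * driftXbar n x₀ μ σ c) / σ ^ 2 = Real.log (1 - (2 * μ / σ ^ 2) * y) := by
    rw [driftXbar, ← hy]
    field_simp
  rw [sB, h, Real.exp_log (by linarith)]
  field_simp
  ring

theorem lamFee_one {n : ℕ} : lamFee n 1 = 0 := by
  simp [lamFee]

theorem strictAntiOn_lamFee {n : ℕ} (hn : 2 ≤ n) : StrictAntiOn (lamFee n) (Set.Icc 0 1) := by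
  have hn' : (2 : ℝ) ≤ n := by exact_mod_cast hn
  have hN : (0 : ℝ) < (n : ℝ) - 1 := by linarith
  have hp : 1 ≤ (n : ℝ) / ((n : ℝ) - 1) := by
    rw [le_div_iff₀ hN]
    linarith
  have hderiv : ∀ x : ℝ, HasDerivAt (lamFee n)
      (-1 + x ^ ((n : ℝ) / ((n : ℝ) - 1) - 1)) x := by
    intro x
    have h := ((((hasDerivAt_id x).const_mul (n : ℝ)).const_sub 1).add
      ((Real.hasDerivAt_rpow_const (x := x) (Or.inr hp)).const_mul ((n : ℝ) - 1))).div_const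
      (n : ℝ)
    refine h.congr_deriv ?_
    field_simp
  refine strictAntiOn_of_deriv_neg (convex_Icc 0 1)
    (fun x _ => (hderiv x).continuousAt.continuousWithinAt) fun x hx => ?_
  rw [interior_Icc] at hx
  rw [(hderiv x).deriv]
  have : x ^ ((n : ℝ) / ((n : ℝ) - 1) - 1) < 1 := by
    refine Real.rpow_lt_one hx.1.le hx.2 ?_
    rw [sub_pos, lt_div_iff₀ hN]
    linarith
  linarith

theorem lamFee_pos {n : ℕ} (hn : 2 ≤ n) {c : ℝ} (hc0 : 0 ≤ c) (hc : c < 1) : 0 < lamFee n c := by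
  rw [← lamFee_one (n := n)]
  exact strictAntiOn_lamFee hn ⟨hc0, hc.le⟩ ⟨zero_le_one, le_rfl⟩ hc

/-- A continuous function which agrees with the equilibrium cdf on `[0, ∞)`. -/
noncomputable def cappedF (n : ℕ) (x₀ μ σ c x : ℝ) : ℝ :=
  (min 1 (c + lamFee n c * sB μ σ x / sB μ σ x₀)) ^ ((1 : ℝ) / ((n : ℝ) - 1))

theorem continuous_cappedF {n : ℕ} (hn : 2 ≤ n) (x₀ μ σ c : ℝ) :
    Continuous (cappedF n x₀ μ σ c) := by
  have hn' : (2 : ℝ) ≤ n := by exact_mod_cast hn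
  have := continuous_sB (μ := μ) (σ := σ)
  unfold cappedF
  exact Continuous.rpow_const (by fun_prop)
    fun _ => Or.inr (one_div_nonneg.2 (by linarith))

section

variable {n : ℕ} {x₀ μ σ c : ℝ}

theorem le_driftXbar_iff (hn : 2 ≤ n) (hx₀ : 0 < x₀) (hσ : 0 < σ) (hμ : μ ≠ 0)
    (hc0 : 0 ≤ c) (hc : c < 1)
    (hcond : (2 * μ / σ ^ 2) * ((1 - c) * sB μ σ x₀ / lamFee n c) < 1) (x : ℝ) :
    x ≤ driftXbar n x₀ μ σ c ↔ c + lamFee n c * sB μ σ x / sB μ σ x₀ ≤ 1 := by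
  have hl := lamFee_pos hn hc0 hc
  have hs := sB_pos hσ hμ hx₀
  rw [← (strictMono_sB hσ hμ).le_iff_le, sB_driftXbar hσ hμ hcond, le_div_iff₀ hl,
    ← le_sub_iff_add_le', div_le_iff₀ hs, mul_comm]

theorem driftXbar_pos (hn : 2 ≤ n) (hx₀ : 0 < x₀) (hσ : 0 < σ) (hμ : μ ≠ 0)
    (hc0 : 0 ≤ c) (hc : c < 1)
    (hcond : (2 * μ / σ ^ 2) * ((1 - c) * sB μ σ x₀ / lamFee n c) < 1) :
    0 < driftXbar n x₀ μ σ c := by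
  have hl := lamFee_pos hn hc0 hc
  have hs := sB_pos hσ hμ hx₀
  rw [← (strictMono_sB hσ hμ).lt_iff_lt, sB_driftXbar hσ hμ hcond, sB_zero]
  exact div_pos (mul_pos (by linarith) hs) hl

theorem cappedF_of_driftXbar_le (hn : 2 ≤ n) (hx₀ : 0 < x₀) (hσ : 0 < σ) (hμ : μ ≠ 0)
    (hc0 : 0 ≤ c) (hc : c < 1)
    (hcond : (2 * μ / σ ^ 2) * ((1 - c) * sB μ σ x₀ / lamFee n c) < 1) {x : ℝ}
    (hx : driftXbar n x₀ μ σ c ≤ x) : cappedF n x₀ μ σ c x = 1 := by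
  have h : 1 ≤ c + lamFee n c * sB μ σ x / sB μ σ x₀ := by
    have hl := lamFee_pos hn hc0 hc
    have hs := sB_pos hσ hμ hx₀
    have h' := (strictMono_sB hσ hμ).monotone hx
    rw [sB_driftXbar hσ hμ hcond, div_le_iff₀ hl] at h'
    rw [← sub_le_iff_le_add', le_div_iff₀ hs]
    linarith
  rw [cappedF, min_eq_left h, Real.one_rpow]

theorem driftF_eq_cappedF (hn : 2 ≤ n) (hx₀ : 0 < x₀) (hσ : 0 < σ) (hμ : μ ≠ 0)
    (hc0 : 0 ≤ c) (hc : c < 1)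
    (hcond : (2 * μ / σ ^ 2) * ((1 - c) * sB μ σ x₀ / lamFee n c) < 1) {x : ℝ} (hx : 0 ≤ x) :
    driftF n x₀ μ σ c x = cappedF n x₀ μ σ c x := by
  rw [driftF, if_neg hx.not_gt]
  split_ifs with h
  · rw [cappedF, min_eq_right ((le_driftXbar_iff hn hx₀ hσ hμ hc0 hc hcond x).1 h)]
  · rw [cappedF_of_driftXbar_le hn hx₀ hσ hμ hc0 hc hcond (not_le.1 h).le]

theorem driftMean_eq_integral_cappedF (hn : 2 ≤ n) (hx₀ : 0 < x₀) (hσ : 0 < σ) (hμ : μ ≠ 0)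
    (hc0 : 0 ≤ c) (hc : c < 1)
    (hcond : (2 * μ / σ ^ 2) * ((1 - c) * sB μ σ x₀ / lamFee n c) < 1) {b : ℝ}
    (hb : driftXbar n x₀ μ σ c ≤ b) :
    driftMean n x₀ μ σ c = ∫ x in (0 : ℝ)..b, (1 - cappedF n x₀ μ σ c x) := by
  have hb0 := (driftXbar_pos hn hx₀ hσ hμ hc0 hc hcond).le.trans hb
  rw [driftMean, intervalIntegral.integral_of_le hb0,
    setIntegral_congr_fun measurableSet_Ioi fun x (hx : 0 < x) => by
      rw [driftF_eq_cappedF hn hx₀ hσ hμ hc0 hc hcond hx.le]]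
  refine setIntegral_eq_of_subset_of_forall_sdiff_eq_zero measurableSet_Ioi
    Set.Ioc_subset_Ioi_self fun x hx => ?_
  have hbx : b < x := not_le.1 fun h => hx.2 ⟨hx.1, h⟩
  rw [cappedF_of_driftXbar_le hn hx₀ hσ hμ hc0 hc hcond (hb.trans hbx.le), sub_self]

/-- In the natural scale, the equilibrium distribution has mean `s_B(x₀)` whatever the fee. -/
theorem integral_one_sub_cappedF_mul_exp (hn : 2 ≤ n) (hx₀ : 0 < x₀) (hσ : 0 < σ) (hμ : μ ≠ 0)
    (hc0 : 0 ≤ c) (hc : c < 1)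
    (hcond : (2 * μ / σ ^ 2) * ((1 - c) * sB μ σ x₀ / lamFee n c) < 1) {b : ℝ}
    (hb : driftXbar n x₀ μ σ c ≤ b) :
    ∫ x in (0 : ℝ)..b, (1 - cappedF n x₀ μ σ c x) * Real.exp (-(2 * μ * x) / σ ^ 2) =
      sB μ σ x₀ := by
  have hn' : (2 : ℝ) ≤ n := by exact_mod_cast hn
  have hN : (0 : ℝ) < (n : ℝ) - 1 := by linarith
  have hl := lamFee_pos hn hc0 hc
  have hs := sB_pos hσ hμ hx₀
  have hX := driftXbar_pos hn hx₀ hσ hμ hc0 hc hcond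
  have hcont : Continuous fun x : ℝ =>
      (1 - cappedF n x₀ μ σ c x) * Real.exp (-(2 * μ * x) / σ ^ 2) := by
    have := continuous_cappedF hn x₀ μ σ c
    fun_prop
  have hsX := sB_driftXbar (n := n) (x₀ := x₀) (c := c) hσ hμ hcond
  set X := driftXbar n x₀ μ σ c with hXdef
  have hp : 1 ≤ (n : ℝ) / ((n : ℝ) - 1) := by
    rw [le_div_iff₀ hN]
    linarith
  have hp' : (n : ℝ) / ((n : ℝ) - 1) - 1 = 1 / ((n : ℝ) - 1) := by
    field_simp
    ring
  have htail : ∫ x in X..b, (1 - cappedF n x₀ μ σ c x) * Real.exp (-(2 * μ * x) / σ ^ 2) = 0 := by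
    rw [← intervalIntegral.integral_zero (a := X) (b := b) (μ := volume)]
    refine intervalIntegral.integral_congr fun x hx => ?_
    rw [Set.uIcc_of_le hb] at hx
    rw [cappedF_of_driftXbar_le hn hx₀ hσ hμ hc0 hc hcond hx.1, sub_self, zero_mul]
  have hbody : ∫ x in (0 : ℝ)..X,
      (1 - cappedF n x₀ μ σ c x) * Real.exp (-(2 * μ * x) / σ ^ 2) = sB μ σ x₀ := by
    have hderiv : ∀ x ∈ Set.uIcc 0 X, HasDerivAt (fun x => sB μ σ x -
        ((n : ℝ) - 1) / n * (sB μ σ x₀ / lamFee n c) *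
          (c + lamFee n c * sB μ σ x / sB μ σ x₀) ^ ((n : ℝ) / ((n : ℝ) - 1)))
        ((1 - cappedF n x₀ μ σ c x) * Real.exp (-(2 * μ * x) / σ ^ 2)) x := by
      intro x hx
      rw [Set.uIcc_of_le hX.le] at hx
      have hd := hasDerivAt_sB hσ hμ x
      have h1 := (((hd.const_mul (lamFee n c)).div_const (sB μ σ x₀)).const_add c).rpow_const
        (p := (n : ℝ) / ((n : ℝ) - 1)) (Or.inr hp)
      refine (hd.sub (h1.const_mul _)).congr_deriv ?_
      rw [cappedF, min_eq_right ((le_driftXbar_iff hn hx₀ hσ hμ hc0 hc hcond x).1 hx.2), hp']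
      field_simp
    rw [intervalIntegral.integral_eq_sub_of_hasDerivAt hderiv (hcont.intervalIntegrable _ _),
      hsX, sB_zero]
    have h1 : c + lamFee n c * ((1 - c) * sB μ σ x₀ / lamFee n c) / sB μ σ x₀ = 1 := by
      field_simp
      ring
    have h2 : ((n : ℝ) - 1) * c ^ ((n : ℝ) / ((n : ℝ) - 1)) = n * lamFee n c - 1 + n * c := by
      rw [lamFee]
      field_simp
      ring
    rw [h1, Real.one_rpow, mul_zero, zero_div, add_zero]
    field_simp
    linear_combination sB μ σ x₀ * h2
  rw [← intervalIntegral.integral_add_adjacent_intervals (hcont.intervalIntegrable 0 X)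
    (hcont.intervalIntegrable X b), htail, hbody, add_zero]

end

/-- A function changing sign once, from negative to positive, loses weight under a decreasing
density normalised at the crossing point. -/
theorem integral_mul_lt_of_crossing {f e : ℝ → ℝ} {t b : ℝ} (hf : Continuous f)
    (he : Continuous e) (hanti : StrictAnti e) (ht : 0 < t) (htb : t ≤ b)
    (hneg : ∀ x ∈ Set.Icc 0 t, f x ≤ 0) (hpos : ∀ x ∈ Set.Ioc t b, 0 ≤ f x) (h0 : f 0 < 0) :
    ∫ x in (0 : ℝ)..b, f x * e x < e t * ∫ x in (0 : ℝ)..b, f x := by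
  rw [← intervalIntegral.integral_const_mul]
  refine intervalIntegral.integral_lt_integral_of_continuousOn_of_le_of_exists_lt
    (ht.trans_le htb) (by fun_prop) (by fun_prop) (fun x hx => ?_)
    ⟨0, ⟨le_rfl, ht.le.trans htb⟩, ?_⟩
  · rcases le_or_gt x t with h | h
    · nlinarith [hneg x ⟨hx.1.le, h⟩, hanti.antitone h]
    · nlinarith [hpos x ⟨h, hx.2⟩, hanti h]
  · nlinarith [hanti ht]

/-- The cdf for the smaller fee crosses the cdf for the larger fee at most once, from below. -/
theorem exists_crossing_cappedF {n : ℕ} (hn : 2 ≤ n) {x₀ σ μ c c' b : ℝ}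
    (hx₀ : 0 < x₀) (hσ : 0 < σ) (hμ : μ ≠ 0) (hc' : 0 ≤ c') (hc'c : c' < c) (hc : c < 1)
    (hb : 0 < b) :
    ∃ t, 0 < t ∧ t ≤ b ∧
      (∀ x ∈ Set.Icc 0 t, cappedF n x₀ μ σ c' x ≤ cappedF n x₀ μ σ c x) ∧
      ∀ x ∈ Set.Ioc t b, cappedF n x₀ μ σ c x ≤ cappedF n x₀ μ σ c' x := by
  have hn' : (2 : ℝ) ≤ n := by exact_mod_cast hn
  have hr : 0 ≤ (1 : ℝ) / ((n : ℝ) - 1) := one_div_nonneg.2 (by linarith)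
  have hs := sB_pos hσ hμ hx₀
  have hl := lamFee_pos hn (hc'.trans hc'c.le) hc
  have hl' := lamFee_pos hn hc' (hc'c.trans hc)
  have hll : lamFee n c < lamFee n c' :=
    strictAntiOn_lamFee hn ⟨hc', (hc'c.trans hc).le⟩ ⟨hc'.trans hc'c.le, hc.le⟩ hc'c
  have hmono : ∀ {a a' x : ℝ}, 0 ≤ a → 0 < lamFee n a → 0 ≤ x →
      a + lamFee n a * sB μ σ x / sB μ σ x₀ ≤ a' + lamFee n a' * sB μ σ x / sB μ σ x₀ →
      cappedF n x₀ μ σ a x ≤ cappedF n x₀ μ σ a' x := by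
    intro a a' x ha hla hx h
    have hsx : 0 ≤ sB μ σ x := by simpa using (strictMono_sB hσ hμ).monotone hx
    exact Real.rpow_le_rpow (le_min zero_le_one (by positivity)) (min_le_min_left 1 h) hr
  let D : ℝ → ℝ := fun x => c' - c + (lamFee n c' - lamFee n c) * (sB μ σ x / sB μ σ x₀)
  have hDmono : Monotone D := by
    intro x y hxy
    have h1 : sB μ σ x / sB μ σ x₀ ≤ sB μ σ y / sB μ σ x₀ :=
      div_le_div_of_nonneg_right ((strictMono_sB hσ hμ).monotone hxy) hs.le
    have := mul_le_mul_of_nonneg_left h1 (sub_pos.2 hll).le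
    simp only [D]
    linarith
  have hDcont : Continuous D := by
    have := continuous_sB (μ := μ) (σ := σ)
    fun_prop
  have hD : ∀ x, D x = c' + lamFee n c' * sB μ σ x / sB μ σ x₀ -
      (c + lamFee n c * sB μ σ x / sB μ σ x₀) := fun x => by
    simp only [D]
    ring
  have hD0 : D 0 < 0 := by simpa [D] using hc'c
  have hle : ∀ x, 0 ≤ x → D x ≤ 0 → cappedF n x₀ μ σ c' x ≤ cappedF n x₀ μ σ c x :=
    fun x hx h => hmono hc' hl' hx (by linarith [hD x])
  have hge : ∀ x, 0 ≤ x → 0 ≤ D x → cappedF n x₀ μ σ c x ≤ cappedF n x₀ μ σ c' x :=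
    fun x hx h => hmono (hc'.trans hc'c.le) hl hx (by linarith [hD x])
  rcases le_or_gt 0 (D b) with h | h
  · obtain ⟨t, ht, hDt⟩ := intermediate_value_Icc hb.le hDcont.continuousOn ⟨hD0.le, h⟩
    have ht0 : 0 < t := ht.1.lt_of_ne fun h0 => by
      rw [← h0] at hDt
      exact hD0.ne hDt
    exact ⟨t, ht0, ht.2, fun x hx => hle x hx.1 ((hDmono hx.2).trans hDt.le),
      fun x hx => hge x (ht0.trans hx.1).le (hDt.ge.trans (hDmono hx.1.le))⟩
  · exact ⟨b, hb, le_rfl, fun x hx => hle x hx.1 ((hDmono hx.2).trans h.le),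
      fun x hx => absurd hx.2 hx.1.not_ge⟩

/-- The average equilibrium performance of an agent is strictly increasing in the
submission fee when `μ > 0` and strictly decreasing when `μ < 0`. -/
theorem driftF_mean_monotone (n : ℕ) (hn : 2 ≤ n) (x₀ σ μ : ℝ)
    (hx₀ : 0 < x₀) (hσ : 0 < σ) (hμ : μ ≠ 0)
    (c c' : ℝ) (hc' : 0 ≤ c') (hc'c : c' < c) (hc : c < 1)
    (hcond : (2 * μ / σ ^ 2) * ((1 - c) * sB μ σ x₀ / lamFee n c) < 1)
    (hcond' : (2 * μ / σ ^ 2) * ((1 - c') * sB μ σ x₀ / lamFee n c') < 1) :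
    (0 < μ → driftMean n x₀ μ σ c' < driftMean n x₀ μ σ c) ∧
    (μ < 0 → driftMean n x₀ μ σ c < driftMean n x₀ μ σ c') := by
  have hn' : (2 : ℝ) ≤ n := by exact_mod_cast hn
  have hc0 := hc'.trans hc'c.le
  have hc1' := hc'c.trans hc
  obtain ⟨b, hXb, hXb'⟩ : ∃ b, driftXbar n x₀ μ σ c ≤ b ∧ driftXbar n x₀ μ σ c' ≤ b :=
    ⟨_, le_max_left _ _, le_max_right _ _⟩
  have hb := (driftXbar_pos hn hx₀ hσ hμ hc0 hc hcond).trans_le hXb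
  obtain ⟨t, ht, htb, hneg, hpos⟩ := exists_crossing_cappedF hn hx₀ hσ hμ hc' hc'c hc hb
  have hG := continuous_cappedF hn x₀ μ σ c
  have hG' := continuous_cappedF hn x₀ μ σ c'
  let f : ℝ → ℝ := fun x => cappedF n x₀ μ σ c' x - cappedF n x₀ μ σ c x
  let e : ℝ → ℝ := fun x => Real.exp (-(2 * μ * x) / σ ^ 2)
  have hf : Continuous f := hG'.sub hG
  have he : Continuous e := by fun_prop
  have hf0 : f 0 < 0 := by
    simp only [f, cappedF, sB_zero, mul_zero, zero_div, add_zero, min_eq_right hc.le,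
      min_eq_right hc1'.le]
    exact sub_neg.2 (Real.rpow_lt_rpow hc' hc'c (one_div_pos.2 (by linarith)))
  have hmean : ∫ x in (0 : ℝ)..b, f x = driftMean n x₀ μ σ c - driftMean n x₀ μ σ c' := by
    rw [driftMean_eq_integral_cappedF hn hx₀ hσ hμ hc0 hc hcond hXb,
      driftMean_eq_integral_cappedF hn hx₀ hσ hμ hc' hc1' hcond' hXb',
      ← intervalIntegral.integral_sub (Continuous.intervalIntegrable (by fun_prop) _ _)
        (Continuous.intervalIntegrable (by fun_prop) _ _)]
    exact intervalIntegral.integral_congr fun x _ => by simp only [f]; ring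
  have hzero : ∫ x in (0 : ℝ)..b, f x * e x = 0 := by
    have h := integral_one_sub_cappedF_mul_exp hn hx₀ hσ hμ hc0 hc hcond hXb
    rw [← integral_one_sub_cappedF_mul_exp hn hx₀ hσ hμ hc' hc1' hcond' hXb', ← sub_eq_zero,
      ← intervalIntegral.integral_sub (Continuous.intervalIntegrable (by fun_prop) _ _)
        (Continuous.intervalIntegrable (by fun_prop) _ _)] at h
    refine Eq.trans (intervalIntegral.integral_congr fun x _ => ?_) h
    simp only [f, e]
    ring
  have hneg' : ∀ x ∈ Set.Icc 0 t, f x ≤ 0 := fun x hx => sub_nonpos.2 (hneg x hx)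
  have hpos' : ∀ x ∈ Set.Ioc t b, 0 ≤ f x := fun x hx => sub_nonneg.2 (hpos x hx)
  have het : 0 < e t := Real.exp_pos _
  have hσ2 : 0 < σ ^ 2 := by positivity
  constructor
  · intro hμ0
    have hanti : StrictAnti e := fun x y hxy => Real.exp_lt_exp.2 <|
      div_lt_div_of_pos_right (by nlinarith) hσ2
    have h := integral_mul_lt_of_crossing hf he hanti ht htb hneg' hpos' hf0
    rw [hzero, hmean] at h
    exact sub_pos.1 (pos_of_mul_pos_right h het.le)
  · intro hμ0
    have hanti : StrictAnti fun x => -e x := fun x y hxy => neg_lt_neg <| Real.exp_lt_exp.2 <|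
      div_lt_div_of_pos_right (by nlinarith) hσ2
    have h := integral_mul_lt_of_crossing hf he.neg hanti ht htb hneg' hpos' hf0
    simp only [Pi.neg_apply, neg_mul, mul_neg, intervalIntegral.integral_neg, hzero, hmean] at h
    exact sub_neg.1 (by nlinarith)
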